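/- Let γ=((a,b),(c,d)) ∈ SL₂(ℤ) with c>0, let m ∈ ℤ_{≥0}, and let ω=(ω₁,ω₂) ∈ ℝ² have entries linearly independent over ℚ; set τ := ω₂/ω₁, x := (m/ℓ_γ, 0), and G₀(ℓ_γ⁻¹T_γ, m) := #(ℤ² ∩ (m/ℓ_γ)·T_γ) − (c/(2ℓ_γ²))·m² − ((ℓ_γ+2)/(2ℓ_γ))·m. Then 𝔷₀(γ)(x,ω) − 𝔷₀(γ)(ℓ_γ·x, ℓ_γ⁻¹·ω) = G₀(ℓ_γ⁻¹T_γ, m) + {m/ℓ_γ} − 1 + (1 − 1_ℤ(m/ℓ_γ))·(sgn(a+cτ)−1)/4. -/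

import Mathlib

open scoped Pointwise Classical
open MeasureTheory

/-- Periodic Bernoulli function `B̄₁`. -/
noncomputable def B1 (y : ℝ) : ℝ := if ∃ n : ℤ, (n : ℝ) = y then 0 else Int.fract y - 1 / 2

/-- Periodic Bernoulli function `B̄₂`. -/
noncomputable def B2 (y : ℝ) : ℝ := Int.fract y ^ 2 - Int.fract y + 1 / 6

/-- Dedekind–Rademacher sum `S(a,c;x)`. -/
noncomputable def DR (a c : ℤ) (x₁ x₂ : ℝ) : ℝ :=
  ∑ m ∈ Finset.range c.natAbs, B1 (x₁ + (x₂ + m) * a / c) * B1 ((x₂ + m) / c)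

/-- Indicator function of `ℤ ⊆ ℚ`. -/
def indZ (q : ℚ) : ℝ := if q.den = 1 then 1 else 0

/-- The cocycle `𝔷₀(γ)(x, ω)` for `γ` with entries `a, b, c, d` and `c ≠ 0`;
only `a` and `c` enter the formula. -/
noncomputable def Z0 (a c : ℤ) (x₁ x₂ : ℚ) (ω₁ ω₂ : ℝ) : ℝ :=
  (Int.gcd a c : ℝ) ^ 2 / (2 * c * ((a : ℝ) + c * (ω₂ / ω₁))) *
      B2 (((c : ℝ) / (Int.gcd a c : ℝ)) * (x₁ : ℝ) - ((a : ℝ) / (Int.gcd a c : ℝ)) * (x₂ : ℝ))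
    + ((a : ℝ) + c * (ω₂ / ω₁)) / (2 * c) * B2 (x₂ : ℝ)
    + Real.sign (c : ℝ) * DR (-a) c (x₁ : ℝ) (x₂ : ℝ)
    - Real.sign ((c : ℝ) * ((a : ℝ) + c * (ω₂ / ω₁))) / 4 * indZ x₁ * indZ x₂

/-- The closed triangle `T_γ` in `ℝ²` with vertices `(0,0)`, `(a−1,c)`, `(−1,0)`. -/
def Tri (a c : ℤ) : Set (ℝ × ℝ) :=
  convexHull ℝ {((0 : ℝ), (0 : ℝ)), (((a : ℝ) - 1), (c : ℝ)), ((-1 : ℝ), (0 : ℝ))}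

/-- Number of integral points in a subset of `ℝ²`. -/
noncomputable def latticeCount (S : Set (ℝ × ℝ)) : ℕ :=
  Set.ncard {p : ℤ × ℤ | ((p.1 : ℝ), (p.2 : ℝ)) ∈ S}

/-- The `0`th Ehrhart coefficient `G₀(ℓ⁻¹ T_σ, m)` of the dilated triangle `ℓ⁻¹ T_σ`,
obtained by subtracting the second and first Ehrhart coefficient terms from the
lattice point count of `(m/ℓ)·T_σ`. -/
noncomputable def G0 (aσ cσ : ℤ) (ℓσ ℓ : ℕ) (m : ℕ) : ℝ :=
  (latticeCount (((m : ℝ) / (ℓ : ℝ)) • Tri aσ cσ) : ℝ)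
    - (cσ : ℝ) / (2 * (ℓ : ℝ) ^ 2) * (m : ℝ) ^ 2
    - ((ℓσ : ℝ) + 2) / (2 * (ℓ : ℝ)) * (m : ℝ)


/-- Sawtooth at a fraction. -/
noncomputable def bet (C : ℕ) (k : ℤ) : ℝ :=
  (k : ℝ) / C - ((k / (C : ℤ) : ℤ) : ℝ) - 1 / 2 + (if (C : ℤ) ∣ k then 1 / 2 else 0)

lemma B1_eq_bet (C : ℕ) (hC : 0 < C) (k : ℤ) : B1 ((k : ℝ) / C) = bet C k := by
  have hC' : (C : ℝ) ≠ 0 := by positivity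
  have hfl : ⌊(k : ℝ) / (C : ℝ)⌋ = k / (C : ℤ) := by
    have := Rat.floor_intCast_div_natCast k C
    rw [← this, ← Rat.floor_cast (α := ℝ)]
    push_cast
    rfl
  have hiff : (∃ n : ℤ, (n : ℝ) = (k : ℝ) / C) ↔ (C : ℤ) ∣ k := by
    constructor
    · rintro ⟨n, hn⟩
      rw [eq_div_iff hC'] at hn
      exact ⟨n, by have : n * (C : ℤ) = k := by exact_mod_cast hn
                   rw [← this]; ring⟩
    · rintro ⟨n, rfl⟩
      exact ⟨n, by push_cast; field_simp⟩
  unfold B1 bet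
  by_cases h : (C : ℤ) ∣ k
  · rw [if_pos (hiff.2 h), if_pos h]
    obtain ⟨n, rfl⟩ := h
    rw [Int.mul_ediv_cancel_left _ (by positivity)]
    push_cast
    field_simp
    ring
  · rw [if_neg (fun h' => h (hiff.1 h')), if_neg h, Int.fract, hfl]
    ring

lemma bet_add (C : ℕ) (hC : 0 < C) (k j : ℤ) : bet C (k + C * j) = bet C k := by
  have hC' : (C : ℝ) ≠ 0 := by positivity
  unfold bet
  rw [Int.add_mul_ediv_left _ _ (by positivity)]
  simp only [dvd_add_left (Dvd.intro j rfl : (C : ℤ) ∣ C * j)]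
  push_cast
  field_simp
  ring

lemma bet_congr (C : ℕ) (hC : 0 < C) (k j : ℤ) (h : (C : ℤ) ∣ j - k) : bet C j = bet C k := by
  obtain ⟨e, he⟩ := h
  rw [show j = k + C * e by linarith, bet_add C hC]

lemma bet_dvd (C : ℕ) (hC : 0 < C) (k : ℤ) (h : (C : ℤ) ∣ k) : bet C k = 0 := by
  rw [bet_congr C hC 0 k (by simpa using h)]
  simp [bet]

lemma bet_neg (C : ℕ) (hC : 0 < C) (k : ℤ) : bet C (-k) = - bet C k := by
  by_cases h : (C : ℤ) ∣ k
  · rw [bet_dvd C hC k h, bet_dvd C hC _ (by simpa using h)]; simp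
  · unfold bet
    rw [if_neg h, if_neg (by simpa using h)]
    have : (-k) / (C : ℤ) = - (k / (C : ℤ)) - 1 := by
      have h0 : 0 < (C : ℤ) := by positivity
      have h1 := Int.emod_add_mul_ediv k C
      have h2 := Int.emod_nonneg k h0.ne'
      have h3 := Int.emod_lt_of_pos k h0
      have h4 : k % (C : ℤ) ≠ 0 := fun h' => h (Int.dvd_of_emod_eq_zero h')
      have h5 : 0 < k % (C : ℤ) := by omega
      rw [Int.ediv_eq_iff_of_pos h0]
      constructor <;> nlinarith
    rw [this]
    push_cast
    ring

lemma bet_succ (C : ℕ) (hC : 0 < C) (k : ℤ) : bet C (k + 1) - bet C k =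
    1 / C - (if (C : ℤ) ∣ k then 1 / 2 else 0) - (if (C : ℤ) ∣ k + 1 then 1 / 2 else 0) := by
  have h0 : 0 < (C : ℤ) := by positivity
  have key : (k + 1) / (C : ℤ) = k / (C : ℤ) + (if (C : ℤ) ∣ k + 1 then 1 else 0) := by
    have h1 := Int.emod_add_mul_ediv k C
    have h2 := Int.emod_nonneg k h0.ne'
    have h3 := Int.emod_lt_of_pos k h0
    split_ifs with h
    · obtain ⟨e, he⟩ := h
      rw [he, Int.mul_ediv_cancel_left _ h0.ne']
      have : k = (C : ℤ) - 1 + C * (e - 1) := by linarith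
      rw [this, Int.add_mul_ediv_left _ _ h0.ne', Int.ediv_eq_zero_of_lt (by omega) (by omega)]
      ring
    · have h4 : k % (C : ℤ) + 1 ≠ C := fun h' => h ⟨k / C + 1, by linarith⟩
      have h5 : k % (C : ℤ) + 1 < C := by omega
      rw [Int.ediv_eq_iff_of_pos h0]
      constructor <;> nlinarith
  unfold bet
  rw [key]
  push_cast
  split_ifs <;> ring

lemma sum_shift (C : ℕ) (f : ℤ → ℝ) (hf : ∀ k, f (k + C) = f k) (n : ℕ) :
    ∑ k ∈ Finset.range C, f (k + n) = ∑ k ∈ Finset.range C, f k := by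
  induction n with
  | zero => simp
  | succ n ih =>
    rw [← ih]
    have h1 := Finset.sum_range_succ (fun k : ℕ => f (k + n)) C
    have h2 := Finset.sum_range_succ' (fun k : ℕ => f (k + n)) C
    have h3 : f ((C : ℤ) + n) = f (((0 : ℕ) : ℤ) + n) := by
      rw [add_comm, hf]; simp
    have h4 : ∀ k : ℕ, f (((k + 1 : ℕ) : ℤ) + n) = f ((k : ℤ) + ((n + 1 : ℕ) : ℤ)) := by
      intro k; congr 1; push_cast; ring
    simp only [h4] at h2
    linarith

lemma sum_bet (C : ℕ) (hC : 0 < C) (a : ℤ) : ∑ k ∈ Finset.range C, bet C (k * a) = 0 := by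
  have h1 := Finset.sum_range_reflect (fun k : ℕ => bet C (k * a)) C
  have h2 := sum_shift C (fun k => bet C (k * a)) (fun k => by
    apply bet_congr C hC; exact ⟨a, by ring⟩) 1
  have h3 : ∑ k ∈ Finset.range C, bet C (((C - 1 - k : ℕ) : ℤ) * a)
      = ∑ k ∈ Finset.range C, - bet C (((k : ℤ) + (1 : ℕ)) * a) := by
    apply Finset.sum_congr rfl
    intro k hk
    rw [Finset.mem_range] at hk
    rw [← bet_neg C hC]
    apply bet_congr C hC
    have : ((C - 1 - k : ℕ) : ℤ) = C - 1 - k := by omega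
    rw [this]
    exact ⟨a, by push_cast; ring⟩
  rw [Finset.sum_neg_distrib] at h3
  linarith

lemma sum_bet_ind (C : ℕ) (hC : 0 < C) (a : ℤ) (n : ℕ) :
    ∑ k ∈ Finset.range C, bet C (k * a) * (if (C : ℤ) ∣ k + n then (1 / 2 : ℝ) else 0)
      = - bet C (n * a) / 2 := by
  have h := sum_shift C (fun k => bet C ((k - n) * a) *
      (if (C : ℤ) ∣ k then (1 / 2 : ℝ) else 0)) (fun k => by
        rw [bet_congr C hC ((k - n) * a) ((k + C - n) * a) ⟨a, by ring⟩]
        simp) n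
  simp only [add_sub_cancel_right] at h
  rw [h, Finset.sum_eq_single 0]
  · have := bet_neg C hC (n * a)
    simp [this]; ring
  · intro b hb hb0
    rw [Finset.mem_range] at hb
    rw [if_neg, mul_zero]
    intro hd
    exact hb0 (Nat.eq_zero_of_dvd_of_lt (by exact_mod_cast hd) hb)
  · intro h; simp at h; omega

lemma P_formula (C : ℕ) (hC : 0 < C) (a : ℤ) (n : ℕ) :
    ∑ k ∈ Finset.range C, bet C (-(k * a)) * bet C (k + n)
      - ∑ k ∈ Finset.range C, bet C (-(k * a)) * bet C k
    = - ∑ k ∈ Finset.range (n + 1), bet C (k * a) + bet C (n * a) / 2 := by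
  induction n with
  | zero => simp [bet]
  | succ n ih =>
    rw [Finset.sum_range_succ]
    have hstep : ∑ k ∈ Finset.range C, bet C (-(k * a)) * bet C (k + (n + 1 : ℕ))
      = ∑ k ∈ Finset.range C, bet C (-(k * a)) * bet C (k + n)
        - (∑ k ∈ Finset.range C, bet C (k * a)) * (1 / C)
        + ∑ k ∈ Finset.range C, bet C (k * a) * (if (C : ℤ) ∣ k + n then (1 / 2 : ℝ) else 0)
        + ∑ k ∈ Finset.range C, bet C (k * a) *
            (if (C : ℤ) ∣ k + (n + 1 : ℕ) then (1 / 2 : ℝ) else 0) := by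
      rw [Finset.sum_mul, ← Finset.sum_sub_distrib, ← Finset.sum_add_distrib,
        ← Finset.sum_add_distrib]
      apply Finset.sum_congr rfl
      intro k _
      have h := bet_succ C hC (k + n)
      have e : (k : ℤ) + (n + 1 : ℕ) = k + n + 1 := by push_cast; ring
      rw [e, bet_neg C hC]
      linear_combination (-bet C (k * a)) * h
    rw [hstep, sum_bet C hC, sum_bet_ind C hC, sum_bet_ind C hC]
    linarith

lemma sum_dvd (C : ℕ) (n : ℕ) :
    ∑ k ∈ Finset.range (n + 1), (if C ∣ k then (1 : ℝ) else 0) = ((n / C : ℕ) : ℝ) + 1 := by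
  induction n with
  | zero => rw [Finset.sum_range_one, if_pos (dvd_zero C)]; simp
  | succ n ih =>
    rw [Finset.sum_range_succ, ih, Nat.succ_div]
    split_ifs <;> push_cast <;> ring

lemma sum_symm_zero (f : ℤ → ℝ) (n : ℕ) (h : ∀ k, f (n - k) = - f k) :
    ∑ k ∈ Finset.range (n + 1), f k = 0 := by
  have h1 := Finset.sum_range_reflect (fun k : ℕ => f k) (n + 1)
  have h3 : ∑ k ∈ Finset.range (n + 1), f ((n + 1 - 1 - k : ℕ) : ℤ)
      = ∑ k ∈ Finset.range (n + 1), - f k := by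
    apply Finset.sum_congr rfl
    intro k hk
    rw [Finset.mem_range] at hk
    rw [← h]
    congr 1
    omega
  rw [Finset.sum_neg_distrib] at h3
  linarith

lemma mem_tri (a c : ℤ) (hc : 0 < c) (x y : ℝ) :
    (x, y) ∈ Tri a c ↔ 0 ≤ y ∧ c * x ≤ (a - 1) * y ∧ a * y ≤ c * x + c := by
  have hc' : (0 : ℝ) < c := by exact_mod_cast hc
  constructor
  · intro h
    have hsub : Tri a c ⊆ {p : ℝ × ℝ | 0 ≤ p.2 ∧ c * p.1 ≤ (a - 1) * p.2 ∧
        a * p.2 ≤ c * p.1 + c} := by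
      apply convexHull_min
      · intro p hp
        simp only [Set.mem_insert_iff, Set.mem_singleton_iff] at hp
        rcases hp with rfl | rfl | rfl
        · exact ⟨le_refl _, by simp, by simpa using hc'.le⟩
        · exact ⟨hc'.le, by simp only []; linarith [mul_comm (c : ℝ) (a - 1)], by
            simp only []; linarith [mul_comm (c : ℝ) (a - 1)]⟩
        · exact ⟨le_refl _, by simpa using hc'.le, by simp⟩
      · intro p hp q hq s t hs ht hst
        obtain ⟨p1, p2, p3⟩ := hp
        obtain ⟨q1, q2, q3⟩ := hq
        simp only [Set.mem_ofPred_eq, Prod.fst_add, Prod.snd_add, Prod.smul_fst, Prod.smul_snd,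
          smul_eq_mul]
        refine ⟨by positivity, ?_, ?_⟩
        · nlinarith [mul_le_mul_of_nonneg_left p2 hs, mul_le_mul_of_nonneg_left q2 ht]
        · have : (c : ℝ) = s * c + t * c := by rw [← add_mul, hst, one_mul]
          nlinarith [mul_le_mul_of_nonneg_left p3 hs, mul_le_mul_of_nonneg_left q3 ht]
    exact hsub h
  · rintro ⟨h1, h2, h3⟩
    have hconv := convex_convexHull ℝ
      ({((0 : ℝ), (0 : ℝ)), (((a : ℝ) - 1), (c : ℝ)), ((-1 : ℝ), (0 : ℝ))} : Set (ℝ × ℝ))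
    have := hconv.sum_mem (t := Finset.univ)
      (w := ![1 - y / c - ((a - 1) * y - c * x) / c, y / c, ((a - 1) * y - c * x) / c])
      (z := ![((0 : ℝ), (0 : ℝ)), (((a : ℝ) - 1), (c : ℝ)), ((-1 : ℝ), (0 : ℝ))])
      (by
        intro i _
        fin_cases i
        · simp only [Fin.zero_eta, Matrix.cons_val_zero]
          have : 1 - y / c - ((a - 1) * y - c * x) / c = (c * x + c - a * y) / c := by
            field_simp; ring
          rw [this]; apply div_nonneg <;> linarith
        · simpa using div_nonneg h1 hc'.le
        · simp only [Fin.reduceFinMk, Matrix.cons_val]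
          apply div_nonneg <;> linarith)
      (by simp [Fin.sum_univ_three]; ring)
      (by
        intro i _
        apply subset_convexHull
        fin_cases i <;> simp)
    unfold Tri
    convert this using 1
    simp only [Fin.sum_univ_three, Matrix.cons_val_zero, Matrix.cons_val_one, Matrix.cons_val]
    ext
    · simp; field_simp; ring
    · simp; field_simp

lemma mem_smul_tri (a c : ℤ) (hc : 0 < c) (t : ℝ) (ht : 0 ≤ t) (x y : ℝ) :
    (x, y) ∈ t • Tri a c ↔ 0 ≤ y ∧ c * x ≤ (a - 1) * y ∧ a * y ≤ c * x + c * t := by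
  have hc' : (0 : ℝ) < c := by exact_mod_cast hc
  rcases ht.eq_or_lt with rfl | ht
  · have hne : (Tri a c).Nonempty := ⟨(0, 0), by rw [mem_tri a c hc]; simp; exact hc.le⟩
    rw [Set.zero_smul_set hne]
    simp only [Set.mem_zero, Prod.mk_eq_zero]
    constructor
    · rintro ⟨rfl, rfl⟩; simp
    · rintro ⟨h1, h2, h3⟩
      have : y = 0 := by nlinarith
      subst this
      refine ⟨?_, rfl⟩
      have : c * x = 0 := by linarith
      rcases mul_eq_zero.1 this with h | h
      · linarith
      · exact h
  · rw [Set.mem_smul_set_iff_inv_smul_mem₀ ht.ne']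
    simp only [Prod.smul_mk, smul_eq_mul]
    rw [mem_tri a c hc]
    have e1 : ∀ z : ℝ, z = t * (t⁻¹ * z) := fun z => by field_simp
    set X := t⁻¹ * x
    set Y := t⁻¹ * y
    rw [show x = t * X from e1 x, show y = t * Y from e1 y]
    have hti := inv_pos.2 ht
    have A : ∀ z : ℝ, 0 ≤ t * z ↔ 0 ≤ z := fun z => by simp [ht]
    rw [A]
    refine and_congr Iff.rfl (and_congr ?_ ?_)
    · rw [← sub_nonneg, ← A, ← sub_nonneg (b := c * (t * X))]
      ring_nf
    · rw [← sub_nonneg, ← A, ← sub_nonneg (b := a * (t * Y))]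
      ring_nf

lemma count_eq (a : ℤ) (C : ℕ) (hC : 0 < C) (t : ℝ) (n : ℕ) (hn : (C : ℝ) * t = n) :
    (latticeCount (t • Tri a C) : ℝ) = ∑ k ∈ Finset.range (n + 1),
      ((((k * (a - 1)) / (C : ℤ) : ℤ) : ℝ) + (((n - k * a) / (C : ℤ) : ℤ) : ℝ) + 1) := by
  have hC' : (0 : ℝ) < C := by positivity
  have hCz : (0 : ℤ) < C := by positivity
  have ht : 0 ≤ t := by
    by_contra h
    push Not at h
    have : (C : ℝ) * t < 0 := mul_neg_of_pos_of_neg hC' h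
    have : (0 : ℝ) ≤ n := by positivity
    linarith
  let F : Finset (Σ _ : ℕ, ℤ) := (Finset.range (n + 1)).sigma
    (fun k => Finset.Icc (-((n - k * a) / (C : ℤ))) ((k * (a - 1)) / (C : ℤ)))
  have hset : {p : ℤ × ℤ | ((p.1 : ℝ), (p.2 : ℝ)) ∈ t • Tri a C}
      = (fun s : (Σ _ : ℕ, ℤ) => (s.2, (s.1 : ℤ))) '' (F : Set (Σ _ : ℕ, ℤ)) := by
    ext ⟨x, y⟩
    simp only [Set.mem_ofPred_eq, Set.mem_image]
    rw [mem_smul_tri a C hCz t ht]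
    have key : (0 ≤ (y : ℝ) ∧ ((C : ℤ) : ℝ) * x ≤ (a - 1) * y ∧
        (a : ℝ) * y ≤ ((C : ℤ) : ℝ) * x + ((C : ℤ) : ℝ) * t) ↔
        (0 ≤ y ∧ C * x ≤ (a - 1) * y ∧ a * y ≤ C * x + n) := by
      rw [show ((C : ℤ) : ℝ) = (C : ℝ) by simp, hn]
      norm_cast
    rw [key]
    constructor
    · rintro ⟨h1, h2, h3⟩
      obtain ⟨k, rfl⟩ := Int.eq_ofNat_of_zero_le h1
      refine ⟨⟨k, x⟩, ?_, rfl⟩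
      simp only [F, Finset.coe_sigma, Set.mem_sigma_iff, Finset.mem_coe, Finset.mem_range,
        Finset.mem_Icc]
      refine ⟨?_, ?_, ?_⟩
      · have : (k : ℤ) ≤ n := by linarith
        omega
      · rw [neg_le, Int.le_ediv_iff_mul_le hCz]; linarith
      · rw [Int.le_ediv_iff_mul_le hCz]; linarith
    · rintro ⟨⟨k, z⟩, hs, he⟩
      simp only [Prod.mk.injEq] at he
      obtain ⟨rfl, rfl⟩ := he
      simp only [F, Finset.coe_sigma, Set.mem_sigma_iff, Finset.mem_coe, Finset.mem_range,
        Finset.mem_Icc] at hs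
      obtain ⟨h1, h2, h3⟩ := hs
      rw [neg_le, Int.le_ediv_iff_mul_le hCz] at h2
      rw [Int.le_ediv_iff_mul_le hCz] at h3
      exact ⟨by positivity, by linarith, by linarith⟩
  have hinj : Function.Injective (fun s : (Σ _ : ℕ, ℤ) => (s.2, (s.1 : ℤ))) := by
    rintro ⟨k, x⟩ ⟨k', x'⟩ h
    simp only [Prod.mk.injEq, Nat.cast_inj] at h
    obtain ⟨rfl, rfl⟩ := h
    rfl
  unfold latticeCount
  rw [hset, Set.ncard_image_of_injective _ hinj, Set.ncard_coe_finset, Finset.card_sigma]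
  push_cast
  apply Finset.sum_congr rfl
  intro k hk
  rw [Finset.mem_range] at hk
  rw [Int.card_Icc]
  have hnn : 0 ≤ (k * (a - 1)) / (C : ℤ) + 1 - -((n - k * a) / (C : ℤ)) := by
    have h1 := Int.lt_ediv_add_one_mul_self (k * (a - 1)) hCz
    have h2 := Int.lt_ediv_add_one_mul_self (n - k * a) hCz
    have h3 : (k : ℤ) ≤ n := by omega
    set u := (k * (a - 1)) / (C : ℤ)
    set v := (n - k * a) / (C : ℤ)
    have : 0 < (u + v + 2) * C := by nlinarith
    have := pos_of_mul_pos_left this hCz.le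
    omega
  have h5 := Int.toNat_of_nonneg hnn
  have h6 : (((k * (a - 1) / (C : ℤ) + 1 - -((n - k * a) / (C : ℤ))).toNat : ℤ) : ℝ) = ((k * (a - 1) / (C : ℤ) + 1 - -((n - k * a) / (C : ℤ)) : ℤ) : ℝ) := by rw [h5]
  rw [Int.cast_natCast] at h6
  rw [h6]
  push_cast
  ring

lemma indZ_div (m l : ℕ) (hl : 0 < l) : indZ ((m : ℚ) / (l : ℚ)) = if l ∣ m then 1 else 0 := by
  unfold indZ
  have : ((m : ℚ) / (l : ℚ)).den = 1 ↔ l ∣ m := by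
    have := Rat.den_div_natCast_eq_one_iff m l hl.ne'
    exact this
  simp only [this]

/-- The core identity. -/
lemma core (a : ℤ) (C l c' m : ℕ) (e : ℤ) (hC : C = c' * l) (hC0 : 0 < C) (ha : a - 1 = l * e)
    (hcop : IsCoprime (c' : ℤ) e) (hcopa : IsCoprime (C : ℤ) a) :
    DR (-a) C ((m : ℝ) / l) 0 - DR (-a) C m 0 =
      G0 a C l l m + Int.fract ((m : ℝ) / l) - 1 - (1 - (if l ∣ m then 1 else 0)) / 4 := by
  have hl : 0 < l := Nat.pos_of_ne_zero (by rintro rfl; simp at hC; omega)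
  have hc' : 0 < c' := Nat.pos_of_ne_zero (by rintro rfl; simp at hC; omega)
  have hlR : (0 : ℝ) < l := by positivity
  have hcR : (0 : ℝ) < c' := by positivity
  have hCR : (C : ℝ) = c' * l := by rw [hC]; push_cast; ring
  have hCp : (0 : ℝ) < C := by positivity
  set n : ℕ := c' * m with hn
  have hnt : (m : ℝ) / l = ((n : ℤ) : ℝ) / C := by
    rw [hCR, hn]; push_cast; field_simp
  have hna : (C : ℤ) ∣ n * a - n := ⟨m * e, by
    rw [hn, hC]; push_cast; linear_combination (c' * m : ℤ) * ha⟩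
  -- Dedekind sums
  have hDR1 : DR (-a) C ((m : ℝ) / l) 0 =
      ∑ k ∈ Finset.range C, bet C (-(k * a)) * bet C (k + n) := by
    have h := sum_shift C (fun k => bet C (n - k * a) * bet C k) (fun k => by
      rw [bet_congr C hC0 (n - k * a) (n - (k + C) * a) ⟨-a, by ring⟩,
        bet_congr C hC0 k (k + C) ⟨1, by ring⟩]) n
    unfold DR
    rw [Int.natAbs_natCast]
    transitivity ∑ k ∈ Finset.range C, bet C (n - k * a) * bet C k
    · apply Finset.sum_congr rfl
      intro k _
      rw [← B1_eq_bet C hC0, ← B1_eq_bet C hC0, hnt]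
      congr 2
      · push_cast; field_simp; ring
      · push_cast; simp
    · rw [← h]
      apply Finset.sum_congr rfl
      intro k _
      rw [bet_congr C hC0 (-(k * a)) (n - (k + n) * a)]
      obtain ⟨u, hu⟩ := hna
      exact ⟨-u, by linarith⟩
  have hDR2 : DR (-a) C m 0 = ∑ k ∈ Finset.range C, bet C (-(k * a)) * bet C k := by
    unfold DR
    rw [Int.natAbs_natCast]
    apply Finset.sum_congr rfl
    intro k _
    rw [bet_congr C hC0 (C * m - k * a) (-(k * a)) ⟨-m, by ring⟩,
      ← B1_eq_bet C hC0, ← B1_eq_bet C hC0]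
    congr 2
    · push_cast; field_simp; ring
    · push_cast; simp
  rw [hDR1, hDR2, P_formula C hC0]
  -- count
  have hcount := count_eq a C hC0 ((m : ℝ) / l) n (by rw [hnt]; push_cast; field_simp)
  have hfloor : ∀ k : ℤ, ((k / (C : ℤ) : ℤ) : ℝ) =
      (k : ℝ) / C - 1 / 2 - bet C k + (if (C : ℤ) ∣ k then 1 else 0) / 2 := by
    intro k; unfold bet; split_ifs <;> ring
  have hd1 : ∀ k : ℕ, (C : ℤ) ∣ k * (a - 1) ↔ c' ∣ k := by
    intro k
    rw [ha, hC]; push_cast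
    rw [show (k : ℤ) * (l * e) = (k * e) * l by ring,
      mul_dvd_mul_iff_right (by positivity : (l : ℤ) ≠ 0), ← Int.natCast_dvd_natCast (m := c')]
    exact ⟨hcop.dvd_of_dvd_mul_right, fun h => h.mul_right _⟩
  have hsum2 : ∑ k ∈ Finset.range (n + 1), (if c' ∣ k then (1 : ℝ) else 0) = m + 1 := by
    rw [sum_dvd, hn, Nat.mul_div_cancel_left _ hc']
  have hd2 : ∀ k : ℕ, (C : ℤ) ∣ n - k * a ↔ (C : ℤ) ∣ (n : ℤ) - k := by
    intro k
    have h0 : (C : ℤ) ∣ (n : ℤ) - k ↔ (C : ℤ) ∣ ((n : ℤ) - k) * a :=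
      ⟨fun h => h.mul_right _, hcopa.dvd_of_dvd_mul_right⟩
    rw [h0]
    rw [show ((n : ℤ) - k) * a = (n - k * a) + (n * a - n) by ring, dvd_add_left hna]
  have hrefl : ∀ f : ℤ → ℝ, ∑ k ∈ Finset.range (n + 1), f ((n : ℤ) - k)
      = ∑ k ∈ Finset.range (n + 1), f k := by
    intro f
    rw [← Finset.sum_range_reflect (fun k : ℕ => f k) (n + 1)]
    apply Finset.sum_congr rfl
    intro k hk
    rw [Finset.mem_range] at hk
    congr 1
    omega
  have hsum3 : ∑ k ∈ Finset.range (n + 1), (if (C : ℤ) ∣ (n : ℤ) - k then (1 : ℝ) else 0)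
      = ((m / l : ℕ) : ℝ) + 1 := by
    rw [hrefl (fun j => if (C : ℤ) ∣ j then (1 : ℝ) else 0)]
    simp only [Int.natCast_dvd_natCast]
    rw [sum_dvd, hn, hC, Nat.mul_div_mul_left _ _ hc']
  have hb1 : ∑ k ∈ Finset.range (n + 1), bet C (k * (a - 1)) = 0 := by
    apply sum_symm_zero (fun k => bet C (k * (a - 1)))
    intro k
    rw [← bet_neg C hC0]
    apply bet_congr C hC0
    rw [show ((n : ℤ) - k) * (a - 1) - -(k * (a - 1)) = n * a - n by ring]
    exact hna
  have hb2 : ∑ k ∈ Finset.range (n + 1), bet C (n - k * a)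
      = ∑ k ∈ Finset.range (n + 1), bet C (k * a) := by
    rw [← hrefl (fun j => bet C (j * a))]
    apply Finset.sum_congr rfl
    intro k _
    apply bet_congr C hC0
    rw [show (n : ℤ) - k * a - (n - k) * a = -(n * a - n) by ring]
    exact (dvd_neg).2 hna
  have hlin : ∑ k ∈ Finset.range (n + 1), ((n : ℝ) - k) / C = (n : ℝ) * (n + 1) / (2 * C) := by
    have h := hrefl (fun j => (j : ℝ) / C)
    push_cast at h
    rw [h, ← Finset.sum_div]
    have h2 : ∀ N : ℕ, ∑ k ∈ Finset.range (N + 1), (k : ℝ) = N * (N + 1) / 2 := by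
      intro N
      induction N with
      | zero => simp
      | succ N ih => rw [Finset.sum_range_succ, ih]; push_cast; ring
    rw [h2]; field_simp
  have hN : (latticeCount (((m : ℝ) / l) • Tri a C) : ℝ) = (n : ℝ) * (n + 1) / (2 * C)
      - ∑ k ∈ Finset.range (n + 1), bet C (k * a) + (m + 1) / 2
      + (((m / l : ℕ) : ℝ) + 1) / 2 := by
    rw [hcount, ← hlin, ← hb2, ← hsum2, ← hsum3]
    suffices h : ∑ k ∈ Finset.range (n + 1),
        ((((k * (a - 1)) / (C : ℤ) : ℤ) : ℝ) + (((n - k * a) / (C : ℤ) : ℤ) : ℝ) + 1)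
        + ∑ k ∈ Finset.range (n + 1), bet C (k * (a - 1)) = _ by
      rw [hb1, add_zero] at h
      exact h
    rw [← Finset.sum_add_distrib,
      Finset.sum_div, Finset.sum_div, ← Finset.sum_sub_distrib,
      ← Finset.sum_add_distrib, ← Finset.sum_add_distrib]
    apply Finset.sum_congr rfl
    intro k _
    rw [hfloor, hfloor]
    simp only [hd1, hd2]
    push_cast
    ring
  have hfr : Int.fract ((m : ℝ) / l) = (m : ℝ) / l - ((m / l : ℕ) : ℝ) := by
    rw [Int.fract, ← natCast_floor_eq_intCast_floor (by positivity), Nat.floor_div_eq_div]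
  have hbn : bet C (n * a) = Int.fract ((m : ℝ) / l) - 1 / 2 + (if l ∣ m then 1 else 0) / 2 := by
    rw [bet_congr C hC0 n (n * a) hna, hfr]
    unfold bet
    have h1 : ((n : ℤ) / (C : ℤ)) = ((m / l : ℕ) : ℤ) := by
      rw [← Int.natCast_div, hn, hC, Nat.mul_div_mul_left _ _ hc']
    have h2 : (C : ℤ) ∣ (n : ℤ) ↔ l ∣ m := by
      rw [Int.natCast_dvd_natCast, hn, hC, mul_dvd_mul_iff_left hc'.ne']
    rw [h1, hnt]
    simp only [h2, Int.cast_natCast]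
    split_ifs <;> ring
  unfold G0
  rw [hN, hbn, hfr]
  have hnR : (n : ℝ) = c' * m := by rw [hn]; push_cast; ring
  rw [Int.cast_natCast, hnR, hCR]
  field_simp
  ring

/-- **Theorem (Statement 2).** The difference of cocycle values in terms of the 0th
Ehrhart coefficient. -/
theorem statement2 (a b c d : ℤ) (hdet : a * d - b * c = 1) (hc : 0 < c) (m : ℕ)
    (ω₁ ω₂ : ℝ) (hω : LinearIndependent ℚ ![ω₁, ω₂]) :
    Z0 a c ((m : ℚ) / (Int.gcd c (a - 1) : ℚ)) 0 ω₁ ω₂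
      - Z0 a c ((Int.gcd c (a - 1) : ℚ) * ((m : ℚ) / (Int.gcd c (a - 1) : ℚ))) 0
          (ω₁ / (Int.gcd c (a - 1) : ℝ)) (ω₂ / (Int.gcd c (a - 1) : ℝ))
    = G0 a c (Int.gcd c (a - 1)) (Int.gcd c (a - 1)) m
      + Int.fract ((m : ℝ) / (Int.gcd c (a - 1) : ℝ)) - 1
      + (1 - indZ ((m : ℚ) / (Int.gcd c (a - 1) : ℚ)))
        * (Real.sign ((a : ℝ) + c * (ω₂ / ω₁)) - 1) / 4 := by
  obtain ⟨C, rfl⟩ := Int.eq_ofNat_of_zero_le hc.le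
  have hC0 : 0 < C := by exact_mod_cast hc
  have hCR : (0 : ℝ) < C := by positivity
  have hcopa : IsCoprime (C : ℤ) a := ⟨-b, d, by linarith⟩
  have hg1 : Int.gcd a C = 1 := Int.isCoprime_iff_gcd_eq_one.1 hcopa.symm
  set l : ℕ := Int.gcd C (a - 1) with hl
  have hl0 : 0 < l := Int.gcd_pos_of_ne_zero_left _ hc.ne'
  have hlR : (0 : ℝ) < l := by positivity
  obtain ⟨u, hu⟩ : l ∣ C := Int.natCast_dvd_natCast.1 (Int.gcd_dvd_left ..)
  obtain ⟨e, he⟩ : (l : ℤ) ∣ a - 1 := Int.gcd_dvd_right ..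
  have hcop : IsCoprime (u : ℤ) e := by
    rw [Int.isCoprime_iff_gcd_eq_one]
    have h1 : Int.gcd ((l : ℤ) * u) (l * e) = l * Int.gcd u e := by
      rw [Int.gcd_mul_left]; simp
    rw [← he, ← Nat.cast_mul, ← hu, ← hl] at h1
    exact Nat.eq_of_mul_eq_mul_left hl0 (by omega)
  have hcore := core a C l u m e (by rw [hu, mul_comm]) hC0 he hcop hcopa
  have hlq : (l : ℚ) ≠ 0 := by positivity
  have hx : (l : ℚ) * ((m : ℚ) / l) = m := by field_simp
  have hw : ω₂ / (l : ℝ) / (ω₁ / l) = ω₂ / ω₁ := div_div_div_cancel_right₀ hlR.ne' _ _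
  have hB : ∀ z : ℤ, B2 (z : ℝ) = 1 / 6 := by intro z; simp [B2]
  have hi1 : indZ (m : ℚ) = 1 := by simp [indZ]
  have hi0 : indZ 0 = 1 := by simp [indZ]
  unfold Z0
  rw [hx, hw, hi1, hi0, indZ_div m l hl0, hg1]
  have hs : Real.sign ((C : ℤ) : ℝ) = 1 := Real.sign_of_pos (by simpa using hC0)
  have hs2 : Real.sign (((C : ℤ) : ℝ) * ((a : ℝ) + ((C : ℤ) : ℝ) * (ω₂ / ω₁)))
      = Real.sign ((a : ℝ) + ((C : ℤ) : ℝ) * (ω₂ / ω₁)) := by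
    rcases lt_trichotomy ((a : ℝ) + ((C : ℤ) : ℝ) * (ω₂ / ω₁)) 0 with h | h | h
    · rw [Real.sign_of_neg h, Real.sign_of_neg (mul_neg_of_pos_of_neg (by simpa using hC0) h)]
    · rw [h, mul_zero]
    · rw [Real.sign_of_pos h, Real.sign_of_pos (mul_pos (by simpa using hC0) h)]
  rw [hs, hs2]
  have e1 : ((C : ℤ) : ℝ) / ((1 : ℕ) : ℝ) * (((m : ℚ) / (l : ℚ) : ℚ) : ℝ)
      - (a : ℝ) / ((1 : ℕ) : ℝ) * ((0 : ℚ) : ℝ) = ((u * m : ℤ) : ℝ) := by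
    rw [hu]; push_cast; field_simp; ring
  have e2 : ((C : ℤ) : ℝ) / ((1 : ℕ) : ℝ) * ((m : ℚ) : ℝ)
      - (a : ℝ) / ((1 : ℕ) : ℝ) * ((0 : ℚ) : ℝ) = ((C * m : ℤ) : ℝ) := by
    push_cast; ring
  rw [e1, e2, hB, hB]
  have e3 : (((m : ℚ) / (l : ℚ) : ℚ) : ℝ) = (m : ℝ) / l := by push_cast; rfl
  have e4 : ((m : ℚ) : ℝ) = (m : ℝ) := by push_cast; rfl
  rw [e3, e4, Rat.cast_zero]
  linear_combination hcore
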